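/- Let 𝕜 be ℝ or ℂ and let H₁ be the 2×2 matrix with rows (1, 1) and (1, −1). If A is a completely pivoted n×n matrix over 𝕜, then the Kronecker product A ⊗ H₁ (a 2n×2n matrix, with index pairs ordered lexicographically) is a completely pivoted 2n×2n matrix and g(A ⊗ H₁) ≥ 2·g(A). -/

import Mathlib

open scoped BigOperators

/-- `geIter A k` is the Gaussian elimination iterate `A^{(k+1)}` (0-indexed, `geIter A 0 = A`).
Entries with row or column index `< k` are left unchanged; they are irrelevant. -/
noncomputable def geIter {𝕜 : Type*} [Field 𝕜] {n : ℕ} (A : Matrix (Fin n) (Fin n) 𝕜) :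
    ℕ → Matrix (Fin n) (Fin n) 𝕜
  | 0 => A
  | k + 1 => fun i j =>
    if h : k < n ∧ k + 1 ≤ i.1 ∧ k + 1 ≤ j.1 then
      geIter A k i j -
        geIter A k i ⟨k, h.1⟩ * geIter A k ⟨k, h.1⟩ j / geIter A k ⟨k, h.1⟩ ⟨k, h.1⟩
    else geIter A k i j

/-- The norm of the pivot `a^{(k+1)}_{k,k}` (0-indexed). -/
noncomputable def pivotNorm {𝕜 : Type*} [RCLike 𝕜] {n : ℕ}
    (A : Matrix (Fin n) (Fin n) 𝕜) (k : ℕ) : ℝ :=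
  if h : k < n then ‖geIter A k ⟨k, h⟩ ⟨k, h⟩‖ else 0

/-- The growth factor `g(A)`. -/
noncomputable def growth {𝕜 : Type*} [RCLike 𝕜] {n : ℕ} (A : Matrix (Fin n) (Fin n) 𝕜) : ℝ :=
  (⨆ k : Fin n, ⨆ i : Fin n, ⨆ j : Fin n,
      if k.1 ≤ i.1 ∧ k.1 ≤ j.1 then ‖geIter A k.1 i j‖ else 0) /
    ⨆ i : Fin n, ⨆ j : Fin n, ‖A i j‖

/-- `A` is completely pivoted: `A ∈ CP_n(𝕜)`. -/
def IsCP {𝕜 : Type*} [RCLike 𝕜] {n : ℕ} (A : Matrix (Fin n) (Fin n) 𝕜) : Prop :=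
  A.det ≠ 0 ∧ (∀ k : ℕ, k + 1 < n → pivotNorm A k ≠ 0) ∧
    ∀ (k : ℕ) (i j : Fin n), k ≤ i.1 → k ≤ j.1 → ‖geIter A k i j‖ ≤ pivotNorm A k

/-- `g[CP_n(𝕜)]`. -/
noncomputable def gCP (𝕜 : Type*) [RCLike 𝕜] (n : ℕ) : ℝ :=
  sSup (growth '' {A : Matrix (Fin n) (Fin n) 𝕜 | IsCP A})

/-- The Kronecker product `A ⊗ B`, with index pairs ordered lexicographically:
the `((i,i'),(j,j'))` entry is `A i j * B i' j'`. -/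
def kron {𝕜 : Type*} [RCLike 𝕜] {m n : ℕ} (hn : 0 < n)
    (A : Matrix (Fin m) (Fin m) 𝕜) (B : Matrix (Fin n) (Fin n) 𝕜) :
    Matrix (Fin (m * n)) (Fin (m * n)) 𝕜 :=
  fun p q =>
    A ⟨p.1 / n, Nat.div_lt_of_lt_mul (Nat.mul_comm m n ▸ p.2)⟩
        ⟨q.1 / n, Nat.div_lt_of_lt_mul (Nat.mul_comm m n ▸ q.2)⟩ *
      B ⟨p.1 % n, Nat.mod_lt _ hn⟩ ⟨q.1 % n, Nat.mod_lt _ hn⟩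

/-- Sign of the entry of `H₁` at the residues of `a`, `b` modulo 2. -/
def hsign (𝕜 : Type*) [RCLike 𝕜] (a b : ℕ) : 𝕜 := if a % 2 = 1 ∧ b % 2 = 1 then -1 else 1

/-- The Kronecker product with the Hadamard matrix. -/
abbrev kH {𝕜 : Type*} [RCLike 𝕜] {n : ℕ} (A : Matrix (Fin n) (Fin n) 𝕜) :
    Matrix (Fin (n * 2)) (Fin (n * 2)) 𝕜 :=
  kron (by norm_num) A (!![1, 1; 1, -1] : Matrix (Fin 2) (Fin 2) 𝕜)

/-- Halving an index. -/
def hf {n : ℕ} (p : Fin (n * 2)) : Fin n := ⟨p.1 / 2, by omega⟩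

lemma norm_hsign {𝕜 : Type*} [RCLike 𝕜] (a b : ℕ) : ‖hsign 𝕜 a b‖ = 1 := by
  unfold hsign; split_ifs <;> simp

lemma kH_apply {𝕜 : Type*} [RCLike 𝕜] {n : ℕ} (A : Matrix (Fin n) (Fin n) 𝕜)
    (p q : Fin (n * 2)) : kH A p q = A (hf p) (hf q) * hsign 𝕜 p.1 q.1 := by
  unfold kH kron hsign hf
  congr 1
  rcases Nat.mod_two_eq_zero_or_one p.1 with h | h <;>
    rcases Nat.mod_two_eq_zero_or_one q.1 with h' | h' <;> simp [h, h']

lemma geIter_succ {𝕜 : Type*} [Field 𝕜] {n : ℕ} (A : Matrix (Fin n) (Fin n) 𝕜) (k : ℕ)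
    (i j : Fin n) (hk : k < n) (hi : k + 1 ≤ i.1) (hj : k + 1 ≤ j.1) :
    geIter A (k + 1) i j = geIter A k i j -
        geIter A k i ⟨k, hk⟩ * geIter A k ⟨k, hk⟩ j / geIter A k ⟨k, hk⟩ ⟨k, hk⟩ := by
  have h : k < n ∧ k + 1 ≤ i.1 ∧ k + 1 ≤ j.1 := ⟨hk, hi, hj⟩
  simp only [geIter, dif_pos h]

lemma elim_rows {𝕜 : Type*} [Field 𝕜] {n : ℕ} (A : Matrix (Fin n) (Fin n) 𝕜)
    (hp : ∀ k (hk : k + 1 < n), geIter A k ⟨k, by omega⟩ ⟨k, by omega⟩ ≠ 0) (k : ℕ) :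
    ∀ i : Fin n, k ≤ i.1 → ∃ u : Fin n → 𝕜, u i = 1 ∧ (∀ j : Fin n, k ≤ j.1 → j ≠ i → u j = 0) ∧
      ∀ j : Fin n, Matrix.vecMul u A j = if j.1 < k then 0 else geIter A k i j := by
  induction k with
  | zero =>
    intro i _
    refine ⟨Pi.single i 1, by simp, ?_, ?_⟩
    · intro j _ hj; simp [hj]
    · intro j; simp [geIter]
  | succ k ih =>
    intro i hi
    have hk : k < n := by omega
    obtain ⟨u, hu1, hu2, hu3⟩ := ih i (by omega)
    obtain ⟨v, hv1, hv2, hv3⟩ := ih ⟨k, hk⟩ le_rfl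
    have hpk := hp k (by omega)
    refine ⟨u - (geIter A k i ⟨k, hk⟩ / geIter A k ⟨k, hk⟩ ⟨k, hk⟩) • v, ?_, ?_, ?_⟩
    · have : v i = 0 := hv2 i (by omega) (by intro h; rw [h] at hi; simp at hi)
      simp [hu1, this]
    · intro j hj hji
      have h1 : v j = 0 := hv2 j (by omega) (by intro h; rw [h] at hj; simp at hj)
      have h2 := hu2 j (by omega) hji
      simp [h1, h2]
    · intro j
      rw [Matrix.sub_vecMul, Matrix.smul_vecMul, Pi.sub_apply, Pi.smul_apply, hu3, hv3]
      rcases lt_trichotomy j.1 k with h | h | h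
      · simp [h, show j.1 < k + 1 by omega]
      · have : j = ⟨k, hk⟩ := Fin.ext h
        subst this
        simp [hpk]
      · rw [if_neg (by omega), if_neg (by omega), if_neg (by omega),
          geIter_succ A k i j hk hi (by omega), smul_eq_mul]
        ring

lemma pivot_ne {𝕜 : Type*} [RCLike 𝕜] {n : ℕ} (A : Matrix (Fin n) (Fin n) 𝕜) (hA : IsCP A)
    (k : ℕ) (hk : k < n) : geIter A k ⟨k, hk⟩ ⟨k, hk⟩ ≠ 0 := by
  obtain ⟨hd, hp, -⟩ := hA
  have hp' : ∀ k (hk : k + 1 < n), geIter A k ⟨k, by omega⟩ ⟨k, by omega⟩ ≠ 0 := by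
    intro k hk
    have := hp k hk
    rw [pivotNorm, dif_pos (by omega)] at this
    simpa using this
  by_cases h : k + 1 < n
  · exact hp' k h
  · intro h0
    obtain ⟨u, hu1, -, hu3⟩ := elim_rows A hp' k ⟨k, hk⟩ le_rfl
    have hz : u = 0 := by
      apply Matrix.eq_zero_of_vecMul_eq_zero hd
      funext j
      rw [hu3]
      split_ifs with hj
      · rfl
      · have : j = ⟨k, hk⟩ := Fin.ext (by simp; omega)
        rw [this, h0]; rfl
    simp [hz] at hu1

lemma ge_odd {𝕜 : Type*} [RCLike 𝕜] {n : ℕ} (A : Matrix (Fin n) (Fin n) 𝕜) (k : ℕ) (hk : k < n)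
    (ih : ∀ p q : Fin (n * 2), 2 * k ≤ p.1 → 2 * k ≤ q.1 →
      geIter (kH A) (2 * k) p q = geIter A k (hf p) (hf q) * hsign 𝕜 p.1 q.1)
    (p q : Fin (n * 2)) (hp : 2 * k + 1 ≤ p.1) (hq : 2 * k + 1 ≤ q.1) :
    geIter (kH A) (2 * k + 1) p q = geIter A k (hf p) (hf q) * hsign 𝕜 p.1 q.1 -
      geIter A k (hf p) ⟨k, hk⟩ * geIter A k ⟨k, hk⟩ (hf q) / geIter A k ⟨k, hk⟩ ⟨k, hk⟩ := by
  have e : hf (⟨2 * k, by omega⟩ : Fin (n * 2)) = ⟨k, hk⟩ := by simp [hf]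
  rw [geIter_succ _ _ p q (by omega) hp hq, ih p q (by omega) (by omega),
    ih p _ (by omega) le_rfl, ih _ q le_rfl (by omega), ih _ _ le_rfl le_rfl, e]
  simp [hsign]

lemma ge_even {𝕜 : Type*} [RCLike 𝕜] {n : ℕ} (A : Matrix (Fin n) (Fin n) 𝕜) (hA : IsCP A)
    (k : ℕ) : ∀ p q : Fin (n * 2), 2 * k ≤ p.1 → 2 * k ≤ q.1 →
      geIter (kH A) (2 * k) p q = geIter A k (hf p) (hf q) * hsign 𝕜 p.1 q.1 := by
  induction k with
  | zero => intro p q _ _; exact kH_apply A p q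
  | succ k ih =>
    intro p q hp hq
    have hk : k < n := by omega
    have e : hf (⟨2 * k + 1, by omega⟩ : Fin (n * 2)) = ⟨k, hk⟩ := by
      simp only [hf, Fin.mk.injEq]; omega
    have h0 := pivot_ne A hA k hk
    rw [show 2 * (k + 1) = 2 * k + 1 + 1 by ring,
      geIter_succ _ _ p q (by omega) (by omega) (by omega),
      ge_odd A k hk ih p q (by omega) (by omega), ge_odd A k hk ih p _ (by omega) le_rfl,
      ge_odd A k hk ih _ q le_rfl (by omega), ge_odd A k hk ih _ _ le_rfl le_rfl, e,
      geIter_succ A k (hf p) (hf q) hk (by simp only [hf]; omega) (by simp only [hf]; omega)]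
    have h1 : (2 * k + 1) % 2 = 1 := by omega
    generalize geIter A k ⟨k, hk⟩ ⟨k, hk⟩ = d at *
    have h2 : (-d - d) ≠ 0 := by
      intro h
      apply h0
      have : (2 : 𝕜) * d = 0 := by linear_combination -h
      simpa using this
    simp only [hsign, h1]
    rcases Nat.mod_two_eq_zero_or_one p.1 with h | h <;>
    rcases Nat.mod_two_eq_zero_or_one q.1 with h' | h' <;> simp [h, h', h0]
    have h3 : -d - d = -2 * d := by ring
    rw [h3]
    field_simp
    ring

lemma pivot_even {𝕜 : Type*} [RCLike 𝕜] {n : ℕ} (A : Matrix (Fin n) (Fin n) 𝕜) (hA : IsCP A)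
    (k : ℕ) : pivotNorm (kH A) (2 * k) = pivotNorm A k := by
  unfold pivotNorm
  by_cases hk : k < n
  · have e : hf (⟨2 * k, by omega⟩ : Fin (n * 2)) = ⟨k, hk⟩ := by simp [hf]
    rw [dif_pos (by omega), dif_pos hk, ge_even A hA k _ _ le_rfl le_rfl, norm_mul, norm_hsign, e,
      mul_one]
  · rw [dif_neg (by omega), dif_neg hk]

lemma pivot_odd {𝕜 : Type*} [RCLike 𝕜] {n : ℕ} (A : Matrix (Fin n) (Fin n) 𝕜) (hA : IsCP A)
    (k : ℕ) : pivotNorm (kH A) (2 * k + 1) = 2 * pivotNorm A k := by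
  unfold pivotNorm
  by_cases hk : k < n
  · have e : hf (⟨2 * k + 1, by omega⟩ : Fin (n * 2)) = ⟨k, hk⟩ := by
      simp only [hf, Fin.mk.injEq]; omega
    have h0 := pivot_ne A hA k hk
    rw [dif_pos (by omega), dif_pos hk, ge_odd A k hk (ge_even A hA k) _ _ le_rfl le_rfl, e]
    have h1 : (2 * k + 1) % 2 = 1 := by omega
    generalize geIter A k ⟨k, hk⟩ ⟨k, hk⟩ = d at *
    have : d * hsign 𝕜 (2 * k + 1) (2 * k + 1) - d * d / d = -(2 * d) := by
      simp only [hsign, h1, and_self, if_true]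
      field_simp
      ring
    simp only [this, norm_neg, norm_mul, RCLike.norm_ofNat]
  · rw [dif_neg (by omega), dif_neg hk, mul_zero]

lemma cp_kH {𝕜 : Type*} [RCLike 𝕜] {n : ℕ} (A : Matrix (Fin n) (Fin n) 𝕜) (hA : IsCP A) :
    IsCP (kH A) := by
  have hpos : ∀ k, k < n → pivotNorm A k ≠ 0 := by
    intro k hk
    rw [pivotNorm, dif_pos hk]
    simpa using pivot_ne A hA k hk
  refine ⟨?_, ?_, ?_⟩
  · have : kH A = (Matrix.kroneckerMap (· * ·) A
        (!![1, 1; 1, -1] : Matrix (Fin 2) (Fin 2) 𝕜)).submatrix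
          finProdFinEquiv.symm finProdFinEquiv.symm := rfl
    rw [this, Matrix.det_submatrix_equiv_self, Matrix.det_kronecker]
    apply mul_ne_zero
    · exact pow_ne_zero _ hA.1
    · apply pow_ne_zero
      rw [Matrix.det_fin_two_of]
      norm_num
  · intro k hk
    obtain ⟨m, rfl | rfl⟩ : ∃ m, k = 2 * m ∨ k = 2 * m + 1 := ⟨k / 2, by omega⟩
    · rw [pivot_even A hA]; exact hpos m (by omega)
    · rw [pivot_odd A hA]; exact mul_ne_zero two_ne_zero (hpos m (by omega))
  · intro k p q hp hq
    obtain ⟨m, rfl | rfl⟩ : ∃ m, k = 2 * m ∨ k = 2 * m + 1 := ⟨k / 2, by omega⟩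
    · rw [pivot_even A hA, ge_even A hA m p q hp hq, norm_mul, norm_hsign, mul_one]
      exact hA.2.2 _ _ _ (by simp only [hf]; omega) (by simp only [hf]; omega)
    · have hm : m < n := by omega
      rw [pivot_odd A hA, ge_odd A m hm (ge_even A hA m) p q hp hq]
      have hP : pivotNorm A m = ‖geIter A m ⟨m, hm⟩ ⟨m, hm⟩‖ := by rw [pivotNorm, dif_pos hm]
      have h1 := hA.2.2 m (hf p) (hf q) (by simp only [hf]; omega) (by simp only [hf]; omega)
      have h2 := hA.2.2 m (hf p) ⟨m, hm⟩ (by simp only [hf]; omega) le_rfl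
      have h3 := hA.2.2 m ⟨m, hm⟩ (hf q) le_rfl (by simp only [hf]; omega)
      have hpm := hpos m hm
      have hp0 : 0 < pivotNorm A m := lt_of_le_of_ne (hP ▸ norm_nonneg _) hpm.symm
      refine (norm_sub_le _ _).trans ?_
      rw [norm_mul, norm_hsign, mul_one, norm_div, norm_mul, ← hP, two_mul]
      refine add_le_add h1 ?_
      rw [div_le_iff₀ hp0]
      exact mul_le_mul h2 h3 (norm_nonneg _) hp0.le

lemma le_sup2 {n : ℕ} (f : Fin n → Fin n → ℝ) (i j : Fin n) : f i j ≤ ⨆ i, ⨆ j, f i j :=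
  (le_ciSup (Set.finite_range (f i)).bddAbove j).trans
    (le_ciSup (f := fun i => ⨆ j, f i j) (Set.finite_range _).bddAbove i)

lemma le_sup3 {n : ℕ} (f : Fin n → Fin n → Fin n → ℝ) (k i j : Fin n) :
    f k i j ≤ ⨆ k, ⨆ i, ⨆ j, f k i j :=
  (le_sup2 (f k) i j).trans
    (le_ciSup (f := fun k => ⨆ i, ⨆ j, f k i j) (Set.finite_range _).bddAbove k)

lemma growth_kH {𝕜 : Type*} [RCLike 𝕜] {n : ℕ} (A : Matrix (Fin n) (Fin n) 𝕜) (hA : IsCP A) :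
    2 * growth A ≤ growth (kH A) := by
  have hden : (⨆ i, ⨆ j, ‖kH A i j‖) = ⨆ i, ⨆ j, ‖A i j‖ := by
    apply le_antisymm
    · have h0 : 0 ≤ ⨆ i, ⨆ j, ‖A i j‖ :=
        Real.iSup_nonneg fun i => Real.iSup_nonneg fun j => norm_nonneg _
      refine Real.iSup_le (fun p => Real.iSup_le (fun q => ?_) h0) h0
      rw [kH_apply, norm_mul, norm_hsign, mul_one]
      exact le_sup2 (fun i j => ‖A i j‖) _ _
    · have h0 : 0 ≤ ⨆ i, ⨆ j, ‖kH A i j‖ :=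
        Real.iSup_nonneg fun i => Real.iSup_nonneg fun j => norm_nonneg _
      refine Real.iSup_le (fun i => Real.iSup_le (fun j => ?_) h0) h0
      have := le_sup2 (fun i j => ‖kH A i j‖) ⟨2 * i.1, by omega⟩ ⟨2 * j.1, by omega⟩
      rw [kH_apply, norm_mul, norm_hsign, mul_one] at this
      simpa [hf] using this
  unfold growth
  rw [hden, ← mul_div_assoc]
  refine div_le_div_of_nonneg_right ?_
    (Real.iSup_nonneg fun i => Real.iSup_nonneg fun j => norm_nonneg _)
  rw [← le_div_iff₀' two_pos]
  have h0 : 0 ≤ (⨆ k : Fin (n * 2), ⨆ i : Fin (n * 2), ⨆ j : Fin (n * 2),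
      if k.1 ≤ i.1 ∧ k.1 ≤ j.1 then ‖geIter (kH A) k.1 i j‖ else 0) / 2 := by
    refine div_nonneg (Real.iSup_nonneg fun k => Real.iSup_nonneg fun i =>
      Real.iSup_nonneg fun j => ?_) two_pos.le
    split_ifs
    · exact norm_nonneg _
    · exact le_rfl
  refine Real.iSup_le (fun k => Real.iSup_le (fun i => Real.iSup_le (fun j => ?_) h0) h0) h0
  split_ifs with h
  · refine (hA.2.2 k.1 i j h.1 h.2).trans ?_
    rw [le_div_iff₀' two_pos, ← pivot_odd A hA, pivotNorm, dif_pos (by omega)]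
    have := le_sup3 (fun k i j : Fin (n * 2) =>
      if k.1 ≤ i.1 ∧ k.1 ≤ j.1 then ‖geIter (kH A) k.1 i j‖ else 0)
      ⟨2 * k.1 + 1, by omega⟩ ⟨2 * k.1 + 1, by omega⟩ ⟨2 * k.1 + 1, by omega⟩
    simpa using this
  · exact h0

/-- tensoring a completely pivoted matrix with the 2×2 Hadamard
matrix `H₁` stays completely pivoted and at least doubles the growth factor. -/
theorem cp_kron_hadamard {𝕜 : Type*} [RCLike 𝕜] {n : ℕ}
    (A : Matrix (Fin n) (Fin n) 𝕜) (hA : IsCP A) :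
    IsCP (kron (by norm_num) A (!![1, 1; 1, -1] : Matrix (Fin 2) (Fin 2) 𝕜)) ∧
      2 * growth A ≤
        growth (kron (by norm_num) A (!![1, 1; 1, -1] : Matrix (Fin 2) (Fin 2) 𝕜)) :=
  ⟨cp_kH A hA, growth_kH A hA⟩
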